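/- Let (g,s) be a signed excursion satisfying property (A) and define the shuffled function f_{g,s}(t) = sup_i h_i·1[t ∈ [a'_i,c'_i]]. Then f_{g,s} is continuous on [0,1]. -/

import Mathlib

open MeasureTheory Set

noncomputable section

/-- `x` is not a one-sided minimum of `g`. -/
def NotOneSidedMin (g : ℝ → ℝ) (x : ℝ) : Prop :=
  x ∈ Set.Ioo (0:ℝ) 1 ∧ ∀ ε > 0, (∃ x₁ ∈ Set.Ioo (x-ε) x, g x₁ < g x) ∧
    (∃ x₂ ∈ Set.Ioo x (x+ε), g x₂ < g x)

/-- `b` is an inner local minimum of `g`. -/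
def IsInnerLocalMin (g : ℝ → ℝ) (b : ℝ) : Prop :=
  b ∈ Set.Ioo (0:ℝ) 1 ∧ ∃ ε > 0, ∀ x ∈ Set.Ioo (b-ε) (b+ε), g b ≤ g x

/-- `b` is a strict (inner) local minimum of `g`. -/
def IsStrictLocalMin (g : ℝ → ℝ) (b : ℝ) : Prop :=
  b ∈ Set.Ioo (0:ℝ) 1 ∧ ∃ ε > 0, ∀ x ∈ Set.Ioo (b-ε) (b+ε), x ≠ b → g b < g x

/-- A CRT excursion. -/
structure IsCRT (g : ℝ → ℝ) : Prop where
  cont : ContinuousOn g (Set.Icc 0 1)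
  nonneg : ∀ t ∈ Set.Icc (0:ℝ) 1, 0 ≤ g t
  pos : ∀ t ∈ Set.Ioo (0:ℝ) 1, 0 < g t
  zero0 : g 0 = 0
  zero1 : g 1 = 0
  dense_min : ∀ x ∈ Set.Icc (0:ℝ) 1, x ∈ closure {b | IsInnerLocalMin g b}
  distinct : ∀ b b', IsInnerLocalMin g b → IsInnerLocalMin g b' → g b = g b' → b = b'
  leaves_full : volume {x | NotOneSidedMin g x} = 1

/-- `β` is the unique minimum point of `g` on `[x,y]`, lies in `(x,y)`,
and is a strict local minimum: the most recent common ancestor of `x < y`. -/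
def IsMrca (g : ℝ → ℝ) (β x y : ℝ) : Prop :=
  x < y ∧ β ∈ Set.Ioo x y ∧ IsStrictLocalMin g β ∧
    (∀ t ∈ Set.Icc x y, g β ≤ g t) ∧ (∀ t ∈ Set.Icc x y, g t = g β → t = β)

/-- `x` and `y` are `g`-comparable. -/
def GComparable (g : ℝ → ℝ) (x y : ℝ) : Prop :=
  ∃ β, IsMrca g β (min x y) (max x y)

/-- `b` enumerates (injectively) the strict local minima of `g`. -/
def IsEnum (g : ℝ → ℝ) (b : ℕ → ℝ) : Prop :=
  Function.Injective b ∧ ∀ β, IsStrictLocalMin g β ↔ ∃ i, b i = β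

/-- The sign-shuffled comparison relation `u ⊲ v` : if the mrca of `u,v` carries
sign `⊕` (`true`) then the smaller goes first, otherwise the bigger goes first. -/
def Tri (g : ℝ → ℝ) (b : ℕ → ℝ) (s : ℕ → Bool) (u v : ℝ) : Prop :=
  ∃ i, (IsMrca g (b i) u v ∧ s i = true) ∨ (IsMrca g (b i) v u ∧ s i = false)

/-- The measure-preserving function `φ_{g,s}`. -/
def phi (g : ℝ → ℝ) (b : ℕ → ℝ) (s : ℕ → Bool) (t : ℝ) : ℝ :=
  (volume {u ∈ Set.Icc (0:ℝ) 1 | Tri g b s u t}).toReal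

def aPt (g : ℝ → ℝ) (β : ℝ) : ℝ := sSup {t | t < β ∧ g t = g β}
def cPt (g : ℝ → ℝ) (β : ℝ) : ℝ := sInf {t | β < t ∧ g t = g β}

def aI (g : ℝ → ℝ) (b : ℕ → ℝ) (i : ℕ) : ℝ := aPt g (b i)
def cI (g : ℝ → ℝ) (b : ℕ → ℝ) (i : ℕ) : ℝ := cPt g (b i)
def aI' (g : ℝ → ℝ) (b : ℕ → ℝ) (s : ℕ → Bool) (i : ℕ) : ℝ := phi g b s (aI g b i)
def cI' (g : ℝ → ℝ) (b : ℕ → ℝ) (s : ℕ → Bool) (i : ℕ) : ℝ :=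
  aI' g b s i + (cI g b i - aI g b i)
def bI' (g : ℝ → ℝ) (b : ℕ → ℝ) (s : ℕ → Bool) (i : ℕ) : ℝ :=
  aI' g b s i + (if s i then b i - aI g b i else cI g b i - b i)

/-- The permuton `μ_{g,s} = (Id, φ_{g,s})_* Leb`. -/
def permuton (g : ℝ → ℝ) (b : ℕ → ℝ) (s : ℕ → Bool) : Measure (ℝ × ℝ) :=
  Measure.map (fun t => (t, phi g b s t)) (volume.restrict (Set.Icc 0 1))

/-- Property (A) of a signed excursion. -/
def PropA (g : ℝ → ℝ) (b : ℕ → ℝ) (s : ℕ → Bool) : Prop :=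
  ∀ i j, i ≠ j →
    Set.Icc (aI' g b s j) (cI' g b s j) ⊆ Set.Icc (aI' g b s i) (cI' g b s i) →
    (∀ y ∈ Set.Icc (g (b i)) (g (b j)),
      y ∈ closure {h | ∃ l, h = g (b l) ∧
        Set.Icc (aI' g b s l) (cI' g b s l) ⊆ Set.Icc (aI' g b s i) (cI' g b s i) ∧
        Set.Icc (aI' g b s j) (cI' g b s j) ⊆ Set.Icc (bI' g b s l) (cI' g b s l)}) ∧
    (∀ y ∈ Set.Icc (g (b i)) (g (b j)),
      y ∈ closure {h | ∃ l, h = g (b l) ∧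
        Set.Icc (aI' g b s l) (cI' g b s l) ⊆ Set.Icc (aI' g b s i) (cI' g b s i) ∧
        Set.Icc (aI' g b s j) (cI' g b s j) ⊆ Set.Icc (aI' g b s l) (bI' g b s l)})

/-- The shuffled excursion `f_{g,s}`. -/
def fShuffle (g : ℝ → ℝ) (b : ℕ → ℝ) (s : ℕ → Bool) (t : ℝ) : ℝ :=
  ⨆ i, Set.indicator (Set.Icc (aI' g b s i) (cI' g b s i)) (fun _ => g (b i)) t

/-- Topological support of a measure. -/
def mSupport {α : Type*} [TopologicalSpace α] [MeasurableSpace α] (μ : Measure α) : Set α :=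
  {x | ∀ U : Set α, IsOpen U → x ∈ U → μ U ≠ 0}

theorem IsInnerLocalMin.isStrictLocalMin {g : ℝ → ℝ} (hg : IsCRT g) {β : ℝ}
    (h : IsInnerLocalMin g β) : IsStrictLocalMin g β := by
  obtain ⟨hβ, ε, hε, hmin⟩ := h
  have hpos : 0 < min ε (min β (1 - β)) :=
    lt_min hε (lt_min hβ.1 (by linarith [hβ.2]))
  refine ⟨hβ, min ε (min β (1 - β)), hpos, fun x hx hne => ?_⟩
  have h1 : min ε (min β (1 - β)) ≤ ε := min_le_left _ _
  have h2 : min ε (min β (1 - β)) ≤ β := (min_le_right _ _).trans (min_le_left _ _)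
  have h3 : min ε (min β (1 - β)) ≤ 1 - β := (min_le_right _ _).trans (min_le_right _ _)
  have hx1 : x ∈ Ioo (β - ε) (β + ε) := ⟨by linarith [hx.1], by linarith [hx.2]⟩
  refine lt_of_le_of_ne (hmin x hx1) fun heq => hne ?_
  refine hg.distinct x β ⟨⟨by linarith [hx.1], by linarith [hx.2]⟩,
    min (x - (β - ε)) (β + ε - x), lt_min (by linarith [hx1.1]) (by linarith [hx1.2]),
    fun y hy => ?_⟩ ⟨hβ, ε, hε, hmin⟩ heq.symm
  have h4 := min_le_left (x - (β - ε)) (β + ε - x)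
  have h5 := min_le_right (x - (β - ε)) (β + ε - x)
  rw [← heq]
  exact hmin y ⟨by linarith [hy.1], by linarith [hy.2]⟩

theorem IsStrictLocalMin.isInnerLocalMin {g : ℝ → ℝ} {β : ℝ}
    (h : IsStrictLocalMin g β) : IsInnerLocalMin g β := by
  obtain ⟨hβ, ε, hε, hmin⟩ := h
  refine ⟨hβ, ε, hε, fun x hx => ?_⟩
  rcases eq_or_ne x β with rfl | hne
  · exact le_rfl
  · exact (hmin x hx hne).le

theorem isInnerLocalMin_of_forall_le {g : ℝ → ℝ} {β x y : ℝ} (h0 : 0 ≤ x) (h1 : y ≤ 1)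
    (hβ : β ∈ Ioo x y) (hmin : ∀ t ∈ Icc x y, g β ≤ g t) : IsInnerLocalMin g β := by
  refine ⟨⟨by linarith [hβ.1], by linarith [hβ.2]⟩, min (β - x) (y - β),
    lt_min (by linarith [hβ.1]) (by linarith [hβ.2]), fun t ht => hmin t ?_⟩
  have h4 := min_le_left (β - x) (y - β)
  have h5 := min_le_right (β - x) (y - β)
  exact ⟨by linarith [ht.1], by linarith [ht.2]⟩

theorem IsCRT.exists_left_level {g : ℝ → ℝ} (hg : IsCRT g) {x h : ℝ} (hx : x ∈ Ioo (0:ℝ) 1)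
    (h0 : 0 < h) (hh : h < g x) :
    ∃ a, 0 < a ∧ a < x ∧ g a = h ∧ ∀ t ∈ Ioc a x, h < g t := by
  have hcont : ContinuousOn g (Icc 0 x) := hg.cont.mono (Icc_subset_Icc_right hx.2.le)
  have hcpt : IsCompact (Icc 0 x ∩ g ⁻¹' Iic h) :=
    isCompact_Icc.of_isClosed_subset
      (hcont.preimage_isClosed_of_isClosed isClosed_Icc isClosed_Iic) inter_subset_left
  obtain ⟨a, ha⟩ := hcpt.exists_isGreatest
    ⟨0, ⟨⟨le_rfl, hx.1.le⟩, by simpa [hg.zero0] using h0.le⟩⟩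
  have hga : g a ≤ h := ha.1.2
  have hgt : ∀ t ∈ Ioc a x, h < g t := by
    intro t ht
    by_contra! hle
    exact absurd (ha.2 ⟨⟨ha.1.1.1.trans ht.1.le, ht.2⟩, hle⟩) (not_le.2 ht.1)
  have hax : a < x := lt_of_le_of_ne ha.1.1.2 (by rintro rfl; linarith)
  have heq : g a = h := by
    obtain ⟨t, ht, hgt'⟩ := intermediate_value_Icc hax.le
      (hcont.mono (Icc_subset_Icc_left ha.1.1.1)) (show h ∈ Icc (g a) (g x) from ⟨hga, hh.le⟩)
    rcases ht.1.eq_or_lt with rfl | hlt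
    · exact hgt'
    · exact absurd hgt' (hgt t ⟨hlt, ht.2⟩).ne'
  refine ⟨a, lt_of_le_of_ne ha.1.1.1 ?_, hax, heq, hgt⟩
  rintro rfl
  linarith [hg.zero0]

theorem IsCRT.exists_right_level {g : ℝ → ℝ} (hg : IsCRT g) {x h : ℝ} (hx : x ∈ Ioo (0:ℝ) 1)
    (h0 : 0 < h) (hh : h < g x) :
    ∃ c, x < c ∧ c < 1 ∧ g c = h ∧ ∀ t ∈ Ico x c, h < g t := by
  have hcont : ContinuousOn g (Icc x 1) := hg.cont.mono (Icc_subset_Icc_left hx.1.le)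
  have hcpt : IsCompact (Icc x 1 ∩ g ⁻¹' Iic h) :=
    isCompact_Icc.of_isClosed_subset
      (hcont.preimage_isClosed_of_isClosed isClosed_Icc isClosed_Iic) inter_subset_left
  obtain ⟨c, hc⟩ := hcpt.exists_isLeast
    ⟨1, ⟨⟨hx.2.le, le_rfl⟩, by simpa [hg.zero1] using h0.le⟩⟩
  have hgc : g c ≤ h := hc.1.2
  have hgt : ∀ t ∈ Ico x c, h < g t := by
    intro t ht
    by_contra! hle
    exact absurd (hc.2 ⟨⟨ht.1, ht.2.le.trans hc.1.1.2⟩, hle⟩) (not_le.2 ht.2)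
  have hxc : x < c := lt_of_le_of_ne hc.1.1.1 (by rintro rfl; linarith)
  have heq : g c = h := by
    obtain ⟨t, ht, hgt'⟩ := intermediate_value_Icc' hxc.le
      (hcont.mono (Icc_subset_Icc_right hc.1.1.2)) (show h ∈ Icc (g c) (g x) from ⟨hgc, hh.le⟩)
    rcases ht.2.eq_or_lt with rfl | hlt
    · exact hgt'
    · exact absurd hgt' (hgt t ⟨ht.1, hlt⟩).ne'
  refine ⟨c, hxc, lt_of_le_of_ne hc.1.1.2 ?_, heq, hgt⟩
  rintro rfl
  linarith [hg.zero1]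

theorem aPt_spec {g : ℝ → ℝ} (hg : IsCRT g) {β : ℝ} (hβ : IsStrictLocalMin g β) :
    0 < aPt g β ∧ aPt g β < β ∧ g (aPt g β) = g β ∧ ∀ t ∈ Icc (aPt g β) β, g β ≤ g t := by
  obtain ⟨h01, ε, hε, hmin⟩ := hβ
  have hx : ∃ x, 0 < x ∧ β - ε < x ∧ x < β := by
    obtain ⟨x, hx1, hx2⟩ := exists_between (max_lt h01.1 (sub_lt_self β hε))
    exact ⟨x, (le_max_left _ _).trans_lt hx1, (le_max_right _ _).trans_lt hx1, hx2⟩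
  obtain ⟨x, hx0, hxε, hxβ⟩ := hx
  have hnear : ∀ t, x ≤ t → t < β → g β < g t := fun t h1 h2 =>
    hmin t ⟨by linarith, by linarith⟩ h2.ne
  obtain ⟨a, ha0, hax, hga, hgt⟩ := hg.exists_left_level (x := x) (h := g β)
    ⟨hx0, by linarith [h01.2]⟩ (hg.pos β h01) (hnear x le_rfl hxβ)
  have hgr : IsGreatest {t | t < β ∧ g t = g β} a := by
    refine ⟨⟨hax.trans hxβ, hga⟩, fun t ht => ?_⟩
    by_contra! hlt
    rcases le_total t x with h | h
    · exact absurd ht.2 (hgt t ⟨hlt, h⟩).ne'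
    · exact absurd ht.2 (hnear t h ht.1).ne'
  have : aPt g β = a := hgr.csSup_eq
  rw [this]
  refine ⟨ha0, hax.trans hxβ, hga, fun t ht => ?_⟩
  rcases ht.1.eq_or_lt with rfl | h1
  · exact hga.ge
  rcases ht.2.eq_or_lt with rfl | h2
  · exact le_rfl
  rcases le_total t x with h | h
  · exact (hgt t ⟨h1, h⟩).le
  · exact (hnear t h h2).le

theorem cPt_spec {g : ℝ → ℝ} (hg : IsCRT g) {β : ℝ} (hβ : IsStrictLocalMin g β) :
    β < cPt g β ∧ cPt g β < 1 ∧ g (cPt g β) = g β ∧ ∀ t ∈ Icc β (cPt g β), g β ≤ g t := by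
  obtain ⟨h01, ε, hε, hmin⟩ := hβ
  have hx : ∃ x, x < 1 ∧ x < β + ε ∧ β < x := by
    obtain ⟨x, hx1, hx2⟩ := exists_between (lt_min h01.2 (lt_add_of_pos_right β hε))
    exact ⟨x, hx2.trans_le (min_le_left _ _), hx2.trans_le (min_le_right _ _), hx1⟩
  obtain ⟨x, hx0, hxε, hxβ⟩ := hx
  have hnear : ∀ t, t ≤ x → β < t → g β < g t := fun t h1 h2 =>
    hmin t ⟨by linarith, by linarith⟩ h2.ne'
  obtain ⟨c, hxc, hc1, hgc, hgt⟩ := hg.exists_right_level (x := x) (h := g β)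
    ⟨by linarith [h01.1], hx0⟩ (hg.pos β h01) (hnear x le_rfl hxβ)
  have hgr : IsLeast {t | β < t ∧ g t = g β} c := by
    refine ⟨⟨hxβ.trans hxc, hgc⟩, fun t ht => ?_⟩
    by_contra! hlt
    rcases le_total x t with h | h
    · exact absurd ht.2 (hgt t ⟨h, hlt⟩).ne'
    · exact absurd ht.2 (hnear t h ht.1).ne'
  have : cPt g β = c := hgr.csInf_eq
  rw [this]
  refine ⟨hxβ.trans hxc, hc1, hgc, fun t ht => ?_⟩
  rcases ht.1.eq_or_lt with rfl | h1
  · exact le_rfl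
  rcases ht.2.eq_or_lt with rfl | h2
  · exact hgc.ge
  rcases le_total x t with h | h
  · exact (hgt t ⟨h, h2⟩).le
  · exact (hnear t h h1).le

/-- The data attached to the `i`-th strict local minimum and its excursion interval. -/
structure BranchInterval (g : ℝ → ℝ) (a β c : ℝ) : Prop where
  a_pos : 0 < a
  a_lt : a < β
  lt_c : β < c
  c_lt : c < 1
  g_a : g a = g β
  g_c : g c = g β
  le : ∀ t ∈ Icc a c, g β ≤ g t
  strict : IsStrictLocalMin g β

theorem IsEnum.isStrictLocalMin {g : ℝ → ℝ} {b : ℕ → ℝ} (hb : IsEnum g b) (i : ℕ) :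
    IsStrictLocalMin g (b i) := (hb.2 _).2 ⟨i, rfl⟩

theorem IsEnum.branchInterval {g : ℝ → ℝ} (hg : IsCRT g) {b : ℕ → ℝ} (hb : IsEnum g b) (i : ℕ) :
    BranchInterval g (aI g b i) (b i) (cI g b i) := by
  have hs := hb.isStrictLocalMin i
  obtain ⟨h1, h2, h3, h4⟩ := aPt_spec hg hs
  obtain ⟨k1, k2, k3, k4⟩ := cPt_spec hg hs
  refine ⟨h1, h2, k1, k2, h3, k3, fun t ht => ?_, hs⟩
  rcases le_total t (b i) with h | h
  · exact h4 t ⟨ht.1, h⟩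
  · exact k4 t ⟨h, ht.2⟩

theorem IsStrictLocalMin.eq_of_eq {g : ℝ → ℝ} (hg : IsCRT g) {β γ : ℝ}
    (hβ : IsStrictLocalMin g β) (hγ : IsStrictLocalMin g γ) (h : g β = g γ) : β = γ :=
  hg.distinct _ _ hβ.isInnerLocalMin hγ.isInnerLocalMin h

theorem IsEnum.height_ne {g : ℝ → ℝ} (hg : IsCRT g) {b : ℕ → ℝ} (hb : IsEnum g b) {i j : ℕ}
    (hij : i ≠ j) : g (b i) ≠ g (b j) := fun h =>
  hij (hb.1 ((hb.isStrictLocalMin i).eq_of_eq hg (hb.isStrictLocalMin j) h))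

/-- Ancestors of a branching point exist at heights in every subinterval below it. -/
theorem IsEnum.exists_ancestor {g : ℝ → ℝ} (hg : IsCRT g) {b : ℕ → ℝ} (hb : IsEnum g b) (k : ℕ)
    {h h' : ℝ} (h0 : 0 ≤ h) (hh' : h < h') (hk : h' < g (b k)) :
    ∃ i, h < g (b i) ∧ g (b i) ≤ h' ∧ b k ∈ Ioo (aI g b i) (cI g b i) := by
  have hbk := (hb.isStrictLocalMin k).1
  obtain ⟨a, ha0, hab, hga, hgta⟩ := hg.exists_left_level hbk (h0.trans_lt hh') hk
  obtain ⟨c, hbc, hc1, hgc, hgtc⟩ := hg.exists_right_level hbk (h0.trans_lt hh') hk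
  have hac : ∀ t ∈ Icc a c, h' ≤ g t := by
    intro t ht
    rcases le_total t (b k) with hle | hle
    · rcases ht.1.eq_or_lt with rfl | h1
      · exact hga.ge
      · exact (hgta t ⟨h1, hle⟩).le
    · rcases ht.2.eq_or_lt with rfl | h1
      · exact hgc.ge
      · exact (hgtc t ⟨hle, h1⟩).le
  have ha1 : a < 1 := by linarith
  have hcontAt : ContinuousAt g a := hg.cont.continuousAt (Icc_mem_nhds ha0 ha1)
  obtain ⟨δ, hδ, hball⟩ := Metric.eventually_nhds_iff.1
    (hcontAt.eventually (lt_mem_nhds (show h < g a by rw [hga]; exact hh')))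
  obtain ⟨p, hp, hpa⟩ := exists_between (max_lt ha0 (sub_lt_self a hδ))
  have hp0 : 0 < p := (le_max_left _ _).trans_lt hp
  have hpδ : a - δ < p := (le_max_right _ _).trans_lt hp
  have hlow : ∀ t ∈ Icc p a, h < g t := fun t ht => by
    refine hball ?_
    rw [Real.dist_eq, abs_lt]
    exact ⟨by linarith [ht.1], by linarith [ht.2]⟩
  obtain ⟨b₀, hb₀, hb₀min⟩ := mem_closure_iff.1
    (hg.dense_min ((p + a) / 2) ⟨by linarith, by linarith⟩) (Ioo p a) isOpen_Ioo
    ⟨by linarith, by linarith⟩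
  obtain ⟨hb₀', ε, hε, hb₀le⟩ := hb₀min
  obtain ⟨x, hx, hxb₀⟩ := exists_between (max_lt hb₀.1 (sub_lt_self b₀ hε))
  have hpx : p < x := (le_max_left _ _).trans_lt hx
  have hxε : b₀ - ε < x := (le_max_right _ _).trans_lt hx
  obtain ⟨β, hβ, hβmin⟩ := (isCompact_Icc (a := b₀) (b := a)).exists_isMinOn
    (nonempty_Icc.2 hb₀.2.le)
    (hg.cont.mono (Icc_subset_Icc hb₀'.1.le ha1.le))
  have hβle : ∀ t ∈ Icc x c, g β ≤ g t := by
    intro t ht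
    rcases le_total t b₀ with h1 | h1
    · exact (hβmin ⟨le_rfl, hb₀.2.le⟩ : g β ≤ g b₀).trans
        (hb₀le t ⟨by linarith [ht.1], by linarith⟩)
    rcases le_total t a with h2 | h2
    · exact hβmin ⟨h1, h2⟩
    · have h3 : g β ≤ g a := hβmin ⟨hb₀.2.le, le_rfl⟩
      linarith [hac t ⟨h2, ht.2⟩]
  have hinner : ∀ γ ∈ Ioo x c, g γ = g β → IsInnerLocalMin g γ := fun γ hγ heq =>
    isInnerLocalMin_of_forall_le (by linarith) hc1.le hγ (by rw [heq]; exact hβle)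
  have hβinner := hinner β ⟨by linarith [hβ.1], by linarith [hβ.2]⟩ rfl
  obtain ⟨i, rfl⟩ := (hb.2 β).1 (hβinner.isStrictLocalMin hg)
  have hI := hb.branchInterval hg i
  refine ⟨i, hlow _ ⟨by linarith [hβ.1], hβ.2⟩, ?_, by linarith [hI.a_lt, hβ.2], ?_⟩
  · rw [← hga]
    exact hβmin ⟨hb₀.2.le, le_rfl⟩
  · by_contra! hle
    have := hg.distinct _ _
      (hinner (cI g b i) ⟨by linarith [hβ.1, hI.lt_c], by linarith⟩ hI.g_c) hβinner hI.g_c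
    linarith [hI.lt_c]

theorem IsMrca.extend_right {g : ℝ → ℝ} {β u v w : ℝ} (h : IsMrca g β u v)
    (hvw : ∀ t ∈ uIcc v w, g β < g t) : IsMrca g β u w := by
  obtain ⟨-, hm, hs, hle, huniq⟩ := h
  have hβw : β < w := by
    by_contra! hw
    exact lt_irrefl _ (hvw β (mem_uIcc.2 (.inr ⟨hw, hm.2.le⟩)))
  refine ⟨hm.1.trans hβw, ⟨hm.1, hβw⟩, hs, fun t ht => ?_, fun t ht heq => ?_⟩
  · rcases le_total t v with h | h
    · exact hle t ⟨ht.1, h⟩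
    · exact (hvw t (mem_uIcc.2 (.inl ⟨h, ht.2⟩))).le
  · rcases le_total t v with h | h
    · exact huniq t ⟨ht.1, h⟩ heq
    · exact absurd heq (hvw t (mem_uIcc.2 (.inl ⟨h, ht.2⟩))).ne'

theorem IsMrca.extend_left {g : ℝ → ℝ} {β u v w : ℝ} (h : IsMrca g β v u)
    (hvw : ∀ t ∈ uIcc v w, g β < g t) : IsMrca g β w u := by
  obtain ⟨-, hm, hs, hle, huniq⟩ := h
  have hβw : w < β := by
    by_contra! hw
    exact lt_irrefl _ (hvw β (mem_uIcc.2 (.inl ⟨hm.1.le, hw⟩)))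
  refine ⟨hβw.trans hm.2, ⟨hβw, hm.2⟩, hs, fun t ht => ?_, fun t ht heq => ?_⟩
  · rcases le_total v t with h | h
    · exact hle t ⟨h, ht.2⟩
    · exact (hvw t (mem_uIcc.2 (.inr ⟨ht.1, h⟩))).le
  · rcases le_total v t with h | h
    · exact huniq t ⟨h, ht.2⟩ heq
    · exact absurd heq (hvw t (mem_uIcc.2 (.inr ⟨ht.1, h⟩))).ne'

theorem BranchInterval.lt_of_isMrca_left {g : ℝ → ℝ} (hg : IsCRT g) {a β c γ u x : ℝ}
    (hI : BranchInterval g a β c) (hx : x ∈ Icc a c) (hu : u < a) (hγ : IsMrca g γ u x) :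
    γ < a ∧ g γ < g β := by
  obtain ⟨-, hm, hs, hle, huniq⟩ := hγ
  have ha : a ∈ Icc u x := ⟨hu.le, hx.1⟩
  have hne : g γ ≠ g β := by
    intro heq
    have h1 := huniq a ha (hI.g_a.trans heq.symm)
    have h2 := hs.eq_of_eq hg hI.strict heq
    linarith [hI.a_lt]
  have hlt : g γ < g β := lt_of_le_of_ne (hI.g_a ▸ hle a ha) hne
  refine ⟨?_, hlt⟩
  by_contra! h
  linarith [hI.le γ ⟨h, hm.2.le.trans hx.2⟩]

theorem BranchInterval.lt_of_isMrca_right {g : ℝ → ℝ} (hg : IsCRT g) {a β c γ u x : ℝ}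
    (hI : BranchInterval g a β c) (hx : x ∈ Icc a c) (hu : c < u) (hγ : IsMrca g γ x u) :
    c < γ ∧ g γ < g β := by
  obtain ⟨-, hm, hs, hle, huniq⟩ := hγ
  have hc : c ∈ Icc x u := ⟨hx.2, hu.le⟩
  have hne : g γ ≠ g β := by
    intro heq
    have h1 := huniq c hc (hI.g_c.trans heq.symm)
    have h2 := hs.eq_of_eq hg hI.strict heq
    linarith [hI.lt_c]
  have hlt : g γ < g β := lt_of_le_of_ne (hI.g_c ▸ hle c hc) hne
  refine ⟨?_, hlt⟩
  by_contra! h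
  linarith [hI.le γ ⟨hx.1.trans hm.1.le, h⟩]

theorem BranchInterval.isMrca_left {g : ℝ → ℝ} (hg : IsCRT g) {a β c γ u x y : ℝ}
    (hI : BranchInterval g a β c) (hx : x ∈ Icc a c) (hy : y ∈ Icc a c) (hu : u < a)
    (hγ : IsMrca g γ u x) : IsMrca g γ u y :=
  hγ.extend_right fun t ht =>
    (hI.lt_of_isMrca_left hg hx hu hγ).2.trans_le (hI.le t (uIcc_subset_Icc hx hy ht))

theorem BranchInterval.isMrca_right {g : ℝ → ℝ} (hg : IsCRT g) {a β c γ u x y : ℝ}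
    (hI : BranchInterval g a β c) (hx : x ∈ Icc a c) (hy : y ∈ Icc a c) (hu : c < u)
    (hγ : IsMrca g γ x u) : IsMrca g γ y u :=
  hγ.extend_left fun t ht =>
    (hI.lt_of_isMrca_right hg hx hu hγ).2.trans_le (hI.le t (uIcc_subset_Icc hx hy ht))

/-- Points of a branch interval cannot be told apart from outside by the shuffled order. -/
theorem BranchInterval.tri_congr {g : ℝ → ℝ} (hg : IsCRT g) {a β c u x y : ℝ}
    (hI : BranchInterval g a β c) {b : ℕ → ℝ} {s : ℕ → Bool} (hx : x ∈ Icc a c)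
    (hy : y ∈ Icc a c) (hu : u ∉ Icc a c) (h : Tri g b s u x) : Tri g b s u y := by
  have hu' : u < a ∨ c < u := by
    by_contra! h'
    exact hu h'
  obtain ⟨i, ⟨hm, hs⟩ | ⟨hm, hs⟩⟩ := h
  · rcases hu' with hu' | hu'
    · exact ⟨i, .inl ⟨hI.isMrca_left hg hx hy hu' hm, hs⟩⟩
    · linarith [hm.1, hx.2]
  · rcases hu' with hu' | hu'
    · linarith [hm.1, hx.1]
    · exact ⟨i, .inr ⟨hI.isMrca_right hg hx hy hu' hm, hs⟩⟩

theorem BranchInterval.notMem_of_tri {g : ℝ → ℝ} {a β c u : ℝ}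
    (hI : BranchInterval g a β c) {b : ℕ → ℝ} {s : ℕ → Bool} (h : Tri g b s u a) :
    u ∉ Icc a c := by
  intro hu
  obtain ⟨i, ⟨hm, -⟩ | ⟨⟨-, hm, -, hle, huniq⟩, -⟩⟩ := h
  · linarith [hm.1, hu.1]
  · have h1 := hI.le (b i) ⟨hm.1.le, hm.2.le.trans hu.2⟩
    have h2 := hle a ⟨le_rfl, hu.1⟩
    have h3 := huniq a ⟨le_rfl, hu.1⟩ (le_antisymm (hI.g_a.trans_le h1) h2)
    linarith [hm.1]

theorem Tri.trans {g : ℝ → ℝ} (hg : IsCRT g) {b : ℕ → ℝ} (hb : IsEnum g b) {s : ℕ → Bool}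
    {u v w : ℝ} (huv : Tri g b s u v) (hvw : Tri g b s v w) : Tri g b s u w := by
  obtain ⟨i, hi⟩ := huv
  obtain ⟨j, hj⟩ := hvw
  rcases eq_or_ne i j with rfl | hij
  · rcases hi with ⟨hm, hs⟩ | ⟨hm, hs⟩ <;> rcases hj with ⟨hm', hs'⟩ | ⟨hm', hs'⟩
    · linarith [hm.2.1.2, hm'.2.1.1]
    · simp [hs] at hs'
    · simp [hs] at hs'
    · linarith [hm.2.1.1, hm'.2.1.2]
  have hui : ∀ t ∈ uIcc u v, g (b i) ≤ g t := by
    rcases hi with ⟨hm, -⟩ | ⟨hm, -⟩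
    · rw [uIcc_of_le hm.1.le]
      exact hm.2.2.2.1
    · rw [uIcc_of_ge hm.1.le]
      exact hm.2.2.2.1
  have huj : ∀ t ∈ uIcc v w, g (b j) ≤ g t := by
    rcases hj with ⟨hm, -⟩ | ⟨hm, -⟩
    · rw [uIcc_of_le hm.1.le]
      exact hm.2.2.2.1
    · rw [uIcc_of_ge hm.1.le]
      exact hm.2.2.2.1
  rcases (hb.height_ne hg hij).lt_or_gt with hlt | hlt
  · have hext : ∀ t ∈ uIcc v w, g (b i) < g t := fun t ht => hlt.trans_le (huj t ht)
    exact ⟨i, hi.imp (fun h => ⟨h.1.extend_right hext, h.2⟩)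
      fun h => ⟨h.1.extend_left hext, h.2⟩⟩
  · have hext : ∀ t ∈ uIcc v u, g (b j) < g t := fun t ht =>
      hlt.trans_le (hui t (uIcc_comm v u ▸ ht))
    exact ⟨j, hj.imp (fun h => ⟨h.1.extend_left hext, h.2⟩)
      fun h => ⟨h.1.extend_right hext, h.2⟩⟩

theorem BranchInterval.mem_Ioo_of_height_lt {g : ℝ → ℝ} {a β c a' β' c' : ℝ}
    (hI : BranchInterval g a β c) (hJ : BranchInterval g a' β' c') (hlt : g β < g β')
    (hmem : β' ∈ Ioo a c) : a < a' ∧ c' < c := by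
  constructor
  · by_contra! h
    linarith [hJ.le a ⟨h, hmem.1.le.trans hJ.lt_c.le⟩, hI.g_a]
  · by_contra! h
    linarith [hJ.le c ⟨hJ.a_lt.le.trans hmem.2.le, h⟩, hI.g_c]

theorem IsEnum.height_lt_of_mem {g : ℝ → ℝ} (hg : IsCRT g) {b : ℕ → ℝ} (hb : IsEnum g b)
    {i j : ℕ} (hij : i ≠ j) (hmem : b j ∈ Ioo (aI g b i) (cI g b i)) : g (b i) < g (b j) :=
  lt_of_le_of_ne ((hb.branchInterval hg i).le _ (Ioo_subset_Icc_self hmem)) (hb.height_ne hg hij)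

theorem volume_tri_ne_top (g : ℝ → ℝ) (b : ℕ → ℝ) (s : ℕ → Bool) (t : ℝ) :
    volume {u ∈ Icc (0:ℝ) 1 | Tri g b s u t} ≠ ⊤ :=
  measure_ne_top_of_subset (sep_subset _ _) measure_Icc_lt_top.ne

theorem phi_mono {g : ℝ → ℝ} {b : ℕ → ℝ} {s : ℕ → Bool} {x y : ℝ}
    (h : ∀ u, Tri g b s u x → Tri g b s u y) : phi g b s x ≤ phi g b s y :=
  ENNReal.toReal_mono (volume_tri_ne_top g b s y) (measure_mono fun u hu => ⟨hu.1, h u hu.2⟩)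

theorem phi_add_length {g : ℝ → ℝ} {b : ℕ → ℝ} {s : ℕ → Bool} {a β c : ℝ}
    (hI : BranchInterval g a β c) :
    phi g b s a + (c - a) =
      (volume ({u ∈ Icc (0:ℝ) 1 | Tri g b s u a} ∪ Icc a c)).toReal := by
  rw [measure_union (disjoint_left.2 fun u hu => hI.notMem_of_tri hu.2) measurableSet_Icc,
    ENNReal.toReal_add (volume_tri_ne_top g b s a) measure_Icc_lt_top.ne, Real.volume_Icc,
    ENNReal.toReal_ofReal (by linarith [hI.a_lt, hI.lt_c])]
  rfl

/-- A branch interval nested in another remains so after shuffling. -/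
theorem IsEnum.shuffled_subset {g : ℝ → ℝ} (hg : IsCRT g) {b : ℕ → ℝ} (hb : IsEnum g b)
    (s : ℕ → Bool) {i j : ℕ} (hij : i ≠ j) (hmem : b j ∈ Ioo (aI g b i) (cI g b i)) :
    aI' g b s i ≤ aI' g b s j ∧ cI' g b s j ≤ cI' g b s i := by
  have hI := hb.branchInterval hg i
  have hJ := hb.branchInterval hg j
  obtain ⟨hac, hcc⟩ := hI.mem_Ioo_of_height_lt hJ (hb.height_lt_of_mem hg hij hmem) hmem
  have hai : aI g b i ∈ Icc (aI g b i) (cI g b i) := ⟨le_rfl, (hI.a_lt.trans hI.lt_c).le⟩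
  have haj : aI g b j ∈ Icc (aI g b i) (cI g b i) :=
    ⟨hac.le, ((hJ.a_lt.trans hJ.lt_c).trans hcc).le⟩
  refine ⟨phi_mono fun u hu => hI.tri_congr hg hai haj (hI.notMem_of_tri hu) hu, ?_⟩
  unfold cI' aI'
  rw [phi_add_length hI, phi_add_length hJ]
  refine ENNReal.toReal_mono (measure_union_lt_top (volume_tri_ne_top g b s _).lt_top
    measure_Icc_lt_top).ne (measure_mono ?_)
  rintro u (hu | hu)
  · by_cases hui : u ∈ Icc (aI g b i) (cI g b i)
    · exact .inr hui
    · exact .inl ⟨hu.1, hI.tri_congr hg haj hai hui hu.2⟩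
  · exact .inr ⟨hac.le.trans hu.1, hu.2.trans hcc.le⟩

theorem IsEnum.shuffled_le_of_tri {g : ℝ → ℝ} (hg : IsCRT g) {b : ℕ → ℝ} (hb : IsEnum g b)
    (s : ℕ → Bool) {i j : ℕ}
    (h : ∀ u ∈ Icc (aI g b i) (cI g b i), Tri g b s u (aI g b j)) :
    cI' g b s i ≤ aI' g b s j := by
  have hI := hb.branchInterval hg i
  have hai : aI g b i ∈ Icc (aI g b i) (cI g b i) := ⟨le_rfl, (hI.a_lt.trans hI.lt_c).le⟩
  unfold cI' aI'
  rw [phi_add_length hI]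
  refine ENNReal.toReal_mono (volume_tri_ne_top g b s _) (measure_mono ?_)
  rintro u (hu | hu)
  · exact ⟨hu.1, hu.2.trans hg hb (h _ hai)⟩
  · exact ⟨⟨hI.a_pos.le.trans hu.1, hu.2.trans hI.c_lt.le⟩, h u hu⟩

theorem IsEnum.nested_or_isMrca {g : ℝ → ℝ} (hg : IsCRT g) {b : ℕ → ℝ} (hb : IsEnum g b)
    {i j : ℕ} (hij : b i < b j) :
    b j ∈ Ioo (aI g b i) (cI g b i) ∨ b i ∈ Ioo (aI g b j) (cI g b j) ∨
      ∃ l, ∀ x ∈ Icc (aI g b i) (cI g b i), ∀ y ∈ Icc (aI g b j) (cI g b j),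
        IsMrca g (b l) x y := by
  have hI := hb.branchInterval hg i
  have hJ := hb.branchInterval hg j
  have hi0 := hI.a_pos.trans hI.a_lt
  have hj1 := hJ.lt_c.trans hJ.c_lt
  obtain ⟨β, hβ, hβmin⟩ := (isCompact_Icc (a := b i) (b := b j)).exists_isMinOn
    (nonempty_Icc.2 hij.le) (hg.cont.mono (Icc_subset_Icc hi0.le hj1.le))
  have hinner : ∀ γ ∈ Ioo (b i) (b j), g γ = g β → IsInnerLocalMin g γ := fun γ hγ heq =>
    isInnerLocalMin_of_forall_le hi0.le hj1.le hγ (by rw [heq]; exact fun t ht => hβmin ht)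
  have hne : i ≠ j := by
    rintro rfl
    exact lt_irrefl _ hij
  rcases eq_or_ne (g β) (g (b i)) with hβi | hβi
  · left
    refine ⟨hI.a_lt.trans hij, ?_⟩
    by_contra! hle
    rcases hle.lt_or_eq with hlt | heq
    · have := hg.distinct _ _ (hinner _ ⟨hI.lt_c, hlt⟩ (hI.g_c.trans hβi.symm))
        hI.strict.isInnerLocalMin hI.g_c
      linarith [hI.lt_c]
    · exact hb.height_ne hg hne (by rw [← heq, hI.g_c])
  rcases eq_or_ne (g β) (g (b j)) with hβj | hβj
  · right; left
    refine ⟨?_, hij.trans hJ.lt_c⟩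
    by_contra! hle
    rcases hle.lt_or_eq with hlt | heq
    · have := hg.distinct _ _ (hinner _ ⟨hlt, hJ.a_lt⟩ (hJ.g_a.trans hβj.symm))
        hJ.strict.isInnerLocalMin hJ.g_a
      linarith [hJ.a_lt]
    · exact hb.height_ne hg hne (by rw [heq, hJ.g_a])
  right; right
  have hlt : ∀ γ ∈ Icc (b i) (b j), g γ = g β → γ ∈ Ioo (b i) (b j) := by
    intro γ hγ heq
    refine ⟨lt_of_le_of_ne hγ.1 ?_, lt_of_le_of_ne hγ.2 ?_⟩
    · rintro rfl
      exact hβi heq.symm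
    · rintro rfl
      exact hβj heq.symm
  have hβinner := hinner β (hlt β hβ rfl) rfl
  have hm : IsMrca g β (b i) (b j) :=
    ⟨hij, hlt β hβ rfl, hβinner.isStrictLocalMin hg, fun t ht => hβmin ht,
      fun t ht heq => hg.distinct _ _ (hinner t (hlt t ht heq) heq) hβinner heq⟩
  obtain ⟨l, rfl⟩ := (hb.2 β).1 (hβinner.isStrictLocalMin hg)
  have hli : g (b l) < g (b i) := lt_of_le_of_ne (hβmin ⟨le_rfl, hij.le⟩) hβi
  have hlj : g (b l) < g (b j) := lt_of_le_of_ne (hβmin ⟨hij.le, le_rfl⟩) hβj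
  refine ⟨l, fun x hx y hy => (hm.extend_left fun t ht => ?_).extend_right fun t ht => ?_⟩
  · exact hli.trans_le (hI.le t (uIcc_subset_Icc ⟨hI.a_lt.le, hI.lt_c.le⟩ hx ht))
  · exact hlj.trans_le (hJ.le t (uIcc_subset_Icc ⟨hJ.a_lt.le, hJ.lt_c.le⟩ hy ht))

/-- Shuffled branch intervals are nested or have disjoint interiors. -/
theorem IsEnum.nested_or_disjoint {g : ℝ → ℝ} (hg : IsCRT g) {b : ℕ → ℝ} (hb : IsEnum g b)
    (s : ℕ → Bool) {i j : ℕ} (hij : i ≠ j) :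
    b j ∈ Ioo (aI g b i) (cI g b i) ∨ b i ∈ Ioo (aI g b j) (cI g b j) ∨
      cI' g b s i ≤ aI' g b s j ∨ cI' g b s j ≤ aI' g b s i := by
  wlog hlt : b i < b j generalizing i j
  · have := this hij.symm (lt_of_le_of_ne (not_lt.1 hlt) fun h => hij (hb.1 h.symm))
    tauto
  have hI := hb.branchInterval hg i
  have hJ := hb.branchInterval hg j
  rcases hb.nested_or_isMrca hg hlt with h | h | ⟨l, h⟩
  · exact .inl h
  · exact .inr (.inl h)
  right; right
  cases hs : s l
  · exact .inr (hb.shuffled_le_of_tri hg s fun u hu =>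
      ⟨l, .inr ⟨h _ ⟨le_rfl, (hI.a_lt.trans hI.lt_c).le⟩ u hu, hs⟩⟩)
  · exact .inl (hb.shuffled_le_of_tri hg s fun u hu =>
      ⟨l, .inl ⟨h u hu _ ⟨le_rfl, (hJ.a_lt.trans hJ.lt_c).le⟩, hs⟩⟩)

theorem IsEnum.bddAbove_heights {g : ℝ → ℝ} (hg : IsCRT g) {b : ℕ → ℝ} (hb : IsEnum g b)
    (s : ℕ → Bool) (t : ℝ) :
    BddAbove (range fun i =>
      indicator (Icc (aI' g b s i) (cI' g b s i)) (fun _ => g (b i)) t) := by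
  obtain ⟨M, hM⟩ := isCompact_Icc.bddAbove_image hg.cont
  refine ⟨M, ?_⟩
  rintro _ ⟨i, rfl⟩
  have hbi := (hb.isStrictLocalMin i).1
  have h : g (b i) ≤ M := hM (mem_image_of_mem g (Ioo_subset_Icc_self hbi))
  by_cases ht : t ∈ Icc (aI' g b s i) (cI' g b s i)
  · simpa [ht] using h
  · simpa [ht] using (hg.pos _ hbi).le.trans h

theorem IsEnum.height_le_fShuffle {g : ℝ → ℝ} (hg : IsCRT g) {b : ℕ → ℝ} (hb : IsEnum g b)
    {s : ℕ → Bool} {t : ℝ} {i : ℕ} (ht : t ∈ Icc (aI' g b s i) (cI' g b s i)) :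
    g (b i) ≤ fShuffle g b s t := by
  have := le_ciSup (hb.bddAbove_heights hg s t) i
  rwa [indicator_of_mem ht] at this

theorem IsEnum.fShuffle_nonneg {g : ℝ → ℝ} (hg : IsCRT g) {b : ℕ → ℝ} (hb : IsEnum g b)
    (s : ℕ → Bool) (t : ℝ) : 0 ≤ fShuffle g b s t :=
  Real.iSup_nonneg fun i => indicator_nonneg (fun _ _ => (hg.pos _ (hb.isStrictLocalMin i).1).le) t

theorem fShuffle_le {g : ℝ → ℝ} {b : ℕ → ℝ} {s : ℕ → Bool} {t M : ℝ} (hM : 0 ≤ M)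
    (h : ∀ i, t ∈ Icc (aI' g b s i) (cI' g b s i) → g (b i) ≤ M) : fShuffle g b s t ≤ M := by
  refine ciSup_le fun i => ?_
  by_cases ht : t ∈ Icc (aI' g b s i) (cI' g b s i)
  · simpa [ht] using h i ht
  · simpa [ht] using hM

theorem IsEnum.shuffled_lt {g : ℝ → ℝ} (hg : IsCRT g) {b : ℕ → ℝ} (hb : IsEnum g b)
    (s : ℕ → Bool) (i : ℕ) : aI' g b s i < bI' g b s i ∧ bI' g b s i < cI' g b s i := by
  have hI := hb.branchInterval hg i
  have h1 := hI.a_lt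
  have h2 := hI.lt_c
  unfold bI' cI'
  split_ifs <;> constructor <;> linarith

/-- Property (A) bounds the shuffled excursion from below near each point. -/
theorem IsEnum.eventually_lt_fShuffle {g : ℝ → ℝ} (hg : IsCRT g) {b : ℕ → ℝ} (hb : IsEnum g b)
    {s : ℕ → Bool} (hA : PropA g b s) {t M : ℝ} (hM : M < fShuffle g b s t) :
    ∀ᶠ u in nhds t, M < fShuffle g b s u := by
  rcases lt_or_ge M 0 with hM0 | hM0
  · exact .of_forall fun u => hM0.trans_le (hb.fShuffle_nonneg hg s u)
  obtain ⟨k, hkt, hk⟩ : ∃ k, t ∈ Icc (aI' g b s k) (cI' g b s k) ∧ M < g (b k) := by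
    by_contra! h
    exact absurd (fShuffle_le hM0 h) (not_le.2 hM)
  obtain ⟨h', h1, h2⟩ := exists_between hk
  obtain ⟨i, hi1, hi2, hik⟩ := hb.exists_ancestor hg k hM0 h1 h2
  have hne : i ≠ k := by
    rintro rfl
    linarith
  obtain ⟨hac, hcc⟩ := hb.shuffled_subset hg s hne hik
  obtain ⟨hr, hl⟩ := hA i k hne (Icc_subset_Icc hac hcc)
  have hk' : g (b k) ∈ Icc (g (b i)) (g (b k)) := ⟨by linarith, le_rfl⟩
  obtain ⟨_, hl1, l, rfl, -, hl2⟩ := mem_closure_iff.1 (hr _ hk') _ isOpen_Ioi hk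
  obtain ⟨_, hm1, m, rfl, -, hm2⟩ := mem_closure_iff.1 (hl _ hk') _ isOpen_Ioi hk
  have hat : aI' g b s l < t := (hb.shuffled_lt hg s l).1.trans_le (hl2 hkt).1
  have htc : t < cI' g b s m := (hm2 hkt).2.trans_lt (hb.shuffled_lt hg s m).2
  filter_upwards [Ioo_mem_nhds hat htc] with u hu
  rcases le_total u t with h | h
  · exact lt_of_lt_of_le hl1 (hb.height_le_fShuffle hg ⟨hu.1.le, h.trans (hl2 hkt).2⟩)
  · exact lt_of_lt_of_le hm1 (hb.height_le_fShuffle hg ⟨(hm2 hkt).1.trans h, hu.2.le⟩)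

/-- Long shuffled intervals at heights above `F` that avoid `t` stay away from `t`. -/
theorem IsEnum.exists_gap {g : ℝ → ℝ} (hg : IsCRT g) {b : ℕ → ℝ} (hb : IsEnum g b)
    (s : ℕ → Bool) (t : ℝ) {h δ : ℝ} (hh : fShuffle g b s t < h) (hδ : 0 < δ) :
    ∃ η > 0, ∀ k, h < g (b k) → δ ≤ cI' g b s k - aI' g b s k →
      η ≤ aI' g b s k - t ∨ η ≤ t - cI' g b s k := by
  have hF := hb.fShuffle_nonneg hg s t
  have hlt : ∀ k, aI' g b s k < cI' g b s k := fun k =>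
    (hb.shuffled_lt hg s k).1.trans (hb.shuffled_lt hg s k).2
  have havoid : ∀ k, h < g (b k) → t < aI' g b s k ∨ cI' g b s k < t := by
    intro k hk
    by_contra! hk'
    linarith [hb.height_le_fShuffle hg hk']
  have hanc : ∀ k, h < g (b k) → ∃ r, g (b r) ≤ h ∧
      (t < aI' g b s r ∨ cI' g b s r < t) ∧
      aI' g b s r ≤ aI' g b s k ∧ cI' g b s k ≤ cI' g b s r := by
    intro k hk
    obtain ⟨r, hr1, hr2, hrk⟩ := hb.exists_ancestor hg k hF hh hk
    have hne : r ≠ k := by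
      rintro rfl
      linarith
    refine ⟨r, hr2, ?_, hb.shuffled_subset hg s hne hrk⟩
    by_contra! hr
    linarith [hb.height_le_fShuffle hg hr]
  have hnest : ∀ r k, g (b r) ≤ h → h < g (b k) →
      aI' g b s r ≤ aI' g b s k ∧ cI' g b s k ≤ cI' g b s r ∨
      cI' g b s r ≤ aI' g b s k ∨ cI' g b s k ≤ aI' g b s r := by
    intro r k hr hk
    have hne : r ≠ k := by
      rintro rfl
      linarith
    rcases hb.nested_or_disjoint hg s hne with h1 | h1 | h1
    · exact .inl (hb.shuffled_subset hg s hne h1)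
    · linarith [hb.height_lt_of_mem hg hne.symm h1]
    · exact .inr h1
  obtain ⟨η₁, hη₁, hright⟩ : ∃ η > 0, ∀ k, h < g (b k) → δ ≤ cI' g b s k - aI' g b s k →
      t < aI' g b s k → η ≤ aI' g b s k - t := by
    by_cases hex : ∃ k, h < g (b k) ∧ t < aI' g b s k ∧ aI' g b s k < t + δ
    · obtain ⟨k₀, hk₀, htk₀, hk₀δ⟩ := hex
      obtain ⟨r, hrh, hrt, har, hcr⟩ := hanc k₀ hk₀
      have hrt' : t < aI' g b s r := hrt.resolve_right fun h1 => by linarith [hlt k₀]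
      refine ⟨aI' g b s r - t, by linarith, fun k hk hkδ htk => ?_⟩
      rcases hnest r k hrh hk with h1 | h1 | h1 <;> linarith [hlt r]
    · push Not at hex
      exact ⟨δ, hδ, fun k hk _ htk => by linarith [hex k hk htk]⟩
  obtain ⟨η₂, hη₂, hleft⟩ : ∃ η > 0, ∀ k, h < g (b k) → δ ≤ cI' g b s k - aI' g b s k →
      cI' g b s k < t → η ≤ t - cI' g b s k := by
    by_cases hex : ∃ k, h < g (b k) ∧ cI' g b s k < t ∧ t - δ < cI' g b s k
    · obtain ⟨k₀, hk₀, htk₀, hk₀δ⟩ := hex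
      obtain ⟨r, hrh, hrt, har, hcr⟩ := hanc k₀ hk₀
      have hrt' : cI' g b s r < t := hrt.resolve_left fun h1 => by linarith [hlt k₀]
      refine ⟨t - cI' g b s r, by linarith, fun k hk hkδ htk => ?_⟩
      rcases hnest r k hrh hk with h1 | h1 | h1 <;> linarith [hlt r]
    · push Not at hex
      exact ⟨δ, hδ, fun k hk _ htk => by linarith [hex k hk htk]⟩
  refine ⟨min η₁ η₂, lt_min hη₁ hη₂, fun k hk hkδ => ?_⟩
  rcases havoid k hk with h1 | h1
  · exact .inl ((min_le_left _ _).trans (hright k hk hkδ h1))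
  · exact .inr ((min_le_right _ _).trans (hleft k hk hkδ h1))

/-- The shuffled excursion is upper semicontinuous. -/
theorem IsEnum.eventually_fShuffle_lt {g : ℝ → ℝ} (hg : IsCRT g) {b : ℕ → ℝ} (hb : IsEnum g b)
    (s : ℕ → Bool) {t M : ℝ} (hM : fShuffle g b s t < M) :
    ∀ᶠ u in nhds t, fShuffle g b s u < M := by
  have hF := hb.fShuffle_nonneg hg s t
  obtain ⟨h₃, hF₃, h₃M⟩ := exists_between hM
  obtain ⟨h₂, hF₂, h₂₃⟩ := exists_between hF₃
  obtain ⟨h₁, hF₁, h₁₂⟩ := exists_between hF₂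
  obtain ⟨δ, hδ, hunif⟩ := Metric.uniformContinuousOn_iff.1
    (isCompact_Icc.uniformContinuousOn_of_continuous hg.cont) (h₃ - h₂) (by linarith)
  obtain ⟨η, hη, hgap⟩ := hb.exists_gap hg s t hF₁ hδ
  filter_upwards [Ioo_mem_nhds (show t - η < t by linarith) (show t < t + η by linarith)]
    with u hu
  refine (fShuffle_le (M := h₃) (by linarith) fun j hj => ?_).trans_lt h₃M
  by_contra! hlt
  obtain ⟨k, hk1, hk2, hkj⟩ :=
    hb.exists_ancestor hg j (hF.trans hF₁.le) h₁₂ (h₂₃.trans hlt)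
  have hne : k ≠ j := by
    rintro rfl
    linarith
  have hK := hb.branchInterval hg k
  obtain ⟨hac, hcc⟩ := hb.shuffled_subset hg s hne hkj
  have hlen : δ ≤ cI' g b s k - aI' g b s k := by
    have hcI' : cI' g b s k - aI' g b s k = cI g b k - aI g b k := add_sub_cancel_left _ _
    rw [hcI']
    by_contra! hshort
    have := hunif (b j) (Ioo_subset_Icc_self (hb.isStrictLocalMin j).1) (aI g b k)
      ⟨hK.a_pos.le, by linarith [hK.a_lt, hK.lt_c, hK.c_lt]⟩
      (by rw [Real.dist_eq, abs_lt]; constructor <;> linarith [hkj.1, hkj.2])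
    rw [Real.dist_eq, abs_lt, hK.g_a] at this
    linarith [this.2]
  rcases hgap k hk1 hlen with h | h
  · linarith [hu.2, hj.1]
  · linarith [hu.1, hj.2]

/-- Under property (A), the shuffled excursion `f_{g,s}` is continuous. -/
theorem stmt15 (g : ℝ → ℝ) (hg : IsCRT g) (b : ℕ → ℝ) (hb : IsEnum g b) (s : ℕ → Bool)
    (hA : PropA g b s) :
    ContinuousOn (fShuffle g b s) (Set.Icc 0 1) :=
  fun _ _ => ContinuousAt.continuousWithinAt <| tendsto_order.2
    ⟨fun _ hM => hb.eventually_lt_fShuffle hg hA hM, fun _ hM => hb.eventually_fShuffle_lt hg s hM⟩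

end
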